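/- Let N ≥ 2, T > 0, L ≥ 0, and let p_1,…,p_N : closure(Q_T) → ℝ satisfy |∂_t p_i| + |∇_x p_i| ≤ L almost everywhere, p_i(z) > 2N/(N+2) on closure(Q_T), and μ := sup_{Q_T} p^∨(z)/p^∧(z) < 1 + 1/N. Fix i ∈ {1,…,N}, a real r with 0 < r < (2N(1−μ)+4)/(N+2), δ ∈ (0,1) and M₀ > 0. Then there exists a constant C, depending on δ, r, L, a, N, T, the bounds of the p_i and M₀, but not on ε or u, such that for every ε ∈ (0,1) and every smooth function u on closure(Q_T) vanishing on the lateral boundary ∂K_a × [0,T] with sup_{t∈(0,T)} ‖u(·,t)‖_{2,K_a} ≤ M₀: ∫_{Q_T} (ε² + |D_i u|²)^{(p_i(z)+r−2)/2} |D_i u|² dz ≤ δ Σ_{j=1}^N ∫_{Q_T} (ε² + |D_i u|²)^{(p_i(z)−2)/2} (D²_{ij} u)² dz + C. -/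

import Mathlib

noncomputable section
open MeasureTheory Real

/-- The open parallelepiped `K_a = {x : |x_i| < a_i}`. -/
def Ka {N : ℕ} (a : Fin N → ℝ) : Set (Fin N → ℝ) := {x | ∀ i, |x i| < a i}

/-- The `i`-th partial derivative `D_i`. -/
def Dop {N : ℕ} (i : Fin N) (f : (Fin N → ℝ) → ℝ) : (Fin N → ℝ) → ℝ :=
  fun x => fderiv ℝ f x (Pi.single i 1)

/-- The `L^q(Ω)` norm. -/
def Lnorm {N : ℕ} (q : ℝ) (Ω : Set (Fin N → ℝ)) (v : (Fin N → ℝ) → ℝ) : ℝ :=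
  (∫ x in Ω, |v x| ^ q) ^ (1 / q)


/-! ### One-dimensional lemma -/

/-- Truncated weight: continuous, `psi b s ^ 2 ≤ 1/|s|`, vanishing for `|s| ≤ b`. -/
def psiT (b s : ℝ) : ℝ := min 1 (max 0 (|s| / b - 1)) / Real.sqrt (max |s| b)

lemma psiT_cont {b : ℝ} (hb : 0 < b) : Continuous (psiT b) := by
  unfold psiT
  apply Continuous.div
  · fun_prop
  · fun_prop
  · intro s
    exact (Real.sqrt_pos.2 (lt_max_of_lt_right hb)).ne'

lemma psiT_nonneg (b s : ℝ) : 0 ≤ psiT b s := by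
  unfold psiT
  apply div_nonneg _ (Real.sqrt_nonneg _)
  exact le_min zero_le_one (le_max_left _ _)

lemma psiT_zero {b s : ℝ} (hb : 0 < b) (h : |s| ≤ b) : psiT b s = 0 := by
  unfold psiT
  have : |s| / b - 1 ≤ 0 := by
    rw [sub_nonpos, div_le_one hb]; exact h
  rw [max_eq_left this]; simp

lemma psiT_sq_le {b s : ℝ} (hb : 0 < b) (h : b ≤ |s|) : psiT b s ^ 2 ≤ 1 / |s| := by
  unfold psiT
  rw [max_eq_left h, div_pow, Real.sq_sqrt (abs_nonneg s)]
  have h1 : min 1 (max 0 (|s| / b - 1)) ≤ 1 := min_le_left _ _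
  have h0 : 0 ≤ min 1 (max 0 (|s| / b - 1)) := le_min zero_le_one (le_max_left _ _)
  have : (0:ℝ) < |s| := lt_of_lt_of_le hb h
  gcongr
  nlinarith

lemma psiT_eq {b s : ℝ} (hb : 0 < b) (h : 2 * b ≤ |s|) : psiT b s = 1 / Real.sqrt |s| := by
  unfold psiT
  have h2 : 1 ≤ |s| / b - 1 := by
    have : 2 ≤ |s| / b := by rw [le_div_iff₀ hb]; exact h
    linarith
  rw [max_eq_left (by linarith : b ≤ |s|), max_eq_right (by linarith), min_eq_left h2]

lemma cs_unit (k : ℝ → ℝ) (hk : ContinuousOn k (Set.uIcc 0 1)) :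
    (∫ τ in (0:ℝ)..1, k τ) ^ 2 ≤ ∫ τ in (0:ℝ)..1, k τ ^ 2 := by
  set m := ∫ τ in (0:ℝ)..1, k τ with hm
  have h0 : 0 ≤ ∫ τ in (0:ℝ)..1, (k τ - m) ^ 2 :=
    intervalIntegral.integral_nonneg zero_le_one (fun x _ => sq_nonneg _)
  have h1 : ∫ τ in (0:ℝ)..1, (k τ - m) ^ 2
      = ∫ τ in (0:ℝ)..1, (k τ ^ 2 - (2 * m) * k τ + m ^ 2) := by
    congr 1; ext τ; ring
  have i1 : IntervalIntegrable (fun τ => k τ ^ 2) volume 0 1 :=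
    (hk.pow 2).intervalIntegrable
  have i2 : IntervalIntegrable (fun τ => (2 * m) * k τ) volume 0 1 :=
    (hk.const_mul (2 * m)).intervalIntegrable
  rw [h1, intervalIntegral.integral_add (i1.sub i2) (by simp),
    intervalIntegral.integral_sub i1 i2, intervalIntegral.integral_const_mul, ← hm] at h0
  simp at h0
  nlinarith

lemma oneD (f f' : ℝ → ℝ) (lam : ℝ) (hlam : 0 < lam)
    (hf : ∀ τ ∈ Set.uIcc (0:ℝ) 1, HasDerivAt f (f' τ) τ)
    (hf' : ContinuousOn f' (Set.uIcc (0:ℝ) 1)) (h0 : lam ≤ f 0) :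
    f 0 / 4 - f 1 ≤ 5 * ∫ τ in (0:ℝ)..1, (psiT (lam / 8) (f τ) * f' τ) ^ 2 := by
  have hb : 0 < lam / 8 := by positivity
  have hfc : ContinuousOn f (Set.uIcc (0:ℝ) 1) := fun τ h =>
    (hf τ h).continuousAt.continuousWithinAt
  have hsub := intervalIntegral.integral_comp_mul_deriv hf hf' (psiT_cont hb)
  have hcs := cs_unit (fun τ => psiT (lam / 8) (f τ) * f' τ)
    (((psiT_cont hb).comp_continuousOn hfc).mul hf')
  simp only [Function.comp] at hsub
  rw [hsub] at hcs
  rw [intervalIntegral.integral_symm] at hcs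
  have hint : ∀ a b : ℝ, IntervalIntegrable (psiT (lam / 8)) volume a b := fun a b =>
    (psiT_cont hb).intervalIntegrable a b
  set a := f 0 with ha
  set b := f 1 with hbdef
  have hapos : 0 < a := by linarith
  by_cases c1 : a / 4 ≤ b
  · have : 0 ≤ ∫ τ in (0:ℝ)..1, (psiT (lam / 8) (f τ) * f' τ) ^ 2 :=
      intervalIntegral.integral_nonneg zero_le_one (fun x _ => sq_nonneg _)
    linarith
  push Not at c1
  -- lower bound helper
  have hmono : ∀ c d m : ℝ, b ≤ c → c ≤ d → d ≤ a → 0 ≤ m →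
      (∀ s ∈ Set.Icc c d, m ≤ psiT (lam / 8) s) → (d - c) * m ≤ ∫ s in b..a, psiT (lam / 8) s := by
    intro c d m h1 h2 h3 hm h4
    have e1 : ∫ s in c..d, m ≤ ∫ s in c..d, psiT (lam / 8) s :=
      intervalIntegral.integral_mono_on h2 (by simp) (hint c d) h4
    have e2 : ∫ s in c..d, psiT (lam / 8) s ≤ ∫ s in b..a, psiT (lam / 8) s :=
      intervalIntegral.integral_mono_interval h1 h2 h3
        (Filter.Eventually.of_forall (fun s => psiT_nonneg _ s)) (hint b a)
    simp at e1
    linarith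
  by_cases c2 : -2 * a ≤ b
  · have hsa : 0 < Real.sqrt a := Real.sqrt_pos.2 hapos
    have := hmono (a / 4) a (1 / Real.sqrt a) c1.le (by linarith) le_rfl (by positivity) (by
      intro s hs
      have hs0 : 0 < s := by linarith [hs.1]
      rw [psiT_eq hb (by rw [abs_of_pos hs0]; linarith [hs.1]), abs_of_pos hs0]
      exact one_div_le_one_div_of_le (Real.sqrt_pos.2 hs0) (Real.sqrt_le_sqrt hs.2))
    have e : (a - a / 4) * (1 / Real.sqrt a) = 3 / 4 * Real.sqrt a := by
      field_simp
      rw [Real.sq_sqrt hapos.le]; ring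
    rw [e] at this
    have hsq := Real.sq_sqrt hapos.le
    nlinarith
  · push Not at c2
    have hbneg : b < 0 := by linarith
    have hsb : 0 < Real.sqrt (-b) := Real.sqrt_pos.2 (by linarith)
    have := hmono b (-a) (1 / Real.sqrt (-b)) le_rfl (by linarith) (by linarith) (by positivity) (by
      intro s hs
      have hs0 : s < 0 := by linarith [hs.2]
      rw [psiT_eq hb (by rw [abs_of_neg hs0]; linarith [hs.2]), abs_of_neg hs0]
      exact one_div_le_one_div_of_le (Real.sqrt_pos.2 (by linarith))
        (Real.sqrt_le_sqrt (by linarith [hs.1])))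
    have e : 1 / 2 * Real.sqrt (-b) ≤ (-a - b) * (1 / Real.sqrt (-b)) := by
      rw [mul_one_div, le_div_iff₀ hsb, mul_assoc, Real.mul_self_sqrt (by linarith)]
      linarith
    have hsq := Real.sq_sqrt (by linarith : 0 ≤ -b)
    nlinarith

/-! ### Measure lemmas -/

lemma ofReal_integral_le' {α : Type*} [MeasurableSpace α] {m : Measure α} {f : α → ℝ}
    (hf : Integrable f m) : ENNReal.ofReal (∫ x, f x ∂m) ≤ ∫⁻ x, ENNReal.ofReal (f x) ∂m := by
  rw [integral_eq_lintegral_pos_part_sub_lintegral_neg_part hf]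
  refine (ENNReal.ofReal_le_ofReal (sub_le_self _ ENNReal.toReal_nonneg)).trans ?_
  exact ENNReal.ofReal_toReal_le

lemma lintegral_affine {N : ℕ} (G : (Fin N → ℝ) → ENNReal) (hG : Measurable G) (c : ℝ) (hc : 0 < c)
    (w : Fin N → ℝ) :
    ∫⁻ y, G (c • y + w) = ENNReal.ofReal ((c ^ N)⁻¹) * ∫⁻ y, G y := by
  have h1 : ∫⁻ y, G (c • y + w) = ∫⁻ y, G (y + w) ∂(Measure.map (fun y => c • y) volume) := by
    rw [lintegral_map (by fun_prop) (by fun_prop)]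
  rw [h1, Measure.map_addHaar_smul _ hc.ne', lintegral_smul_measure, lintegral_add_right_eq_self]
  simp [abs_of_pos hc]

lemma Ka_eq {N : ℕ} (a : Fin N → ℝ) : Ka a = Set.univ.pi (fun i => Set.Ioo (-a i) (a i)) := by
  ext x; simp [Ka, abs_lt]

lemma Ka_open {N : ℕ} (a : Fin N → ℝ) : IsOpen (Ka a) := by
  rw [Ka_eq]; exact isOpen_set_pi Set.finite_univ (fun i _ => isOpen_Ioo)

lemma Ka_convex {N : ℕ} (a : Fin N → ℝ) : Convex ℝ (Ka a) := by
  rw [Ka_eq]; exact convex_pi (fun i _ => convex_Ioo _ _)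

lemma Ka_closure {N : ℕ} (a : Fin N → ℝ) (ha : ∀ i, 0 < a i) :
    closure (Ka a) = Set.univ.pi (fun i => Set.Icc (-a i) (a i)) := by
  rw [Ka_eq, closure_pi_set]
  congr 1; ext i : 1
  exact closure_Ioo (by linarith [ha i])

lemma Ka_closure_compact {N : ℕ} (a : Fin N → ℝ) (ha : ∀ i, 0 < a i) :
    IsCompact (closure (Ka a)) := by
  rw [Ka_closure a ha]; exact isCompact_univ_pi (fun i => isCompact_Icc)

lemma Ka_vol {N : ℕ} (a : Fin N → ℝ) (ha : ∀ i, 0 < a i) : volume (Ka a) < ⊤ :=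
  (measure_mono subset_closure).trans_lt (Ka_closure_compact a ha).measure_lt_top

lemma Ka_zero {N : ℕ} (a : Fin N → ℝ) (ha : ∀ i, 0 < a i) : (0 : Fin N → ℝ) ∈ Ka a := by
  intro i; simpa using ha i

lemma Ka_diff {N : ℕ} (a : Fin N → ℝ) (ha : ∀ i, 0 < a i) {x y : Fin N → ℝ}
    (hx : x ∈ Ka a) (hy : y ∈ Ka a) (j : Fin N) : |y j - x j| ≤ 2 * ∑ k, a k := by
  have h1 := abs_lt.1 (hx j)
  have h2 := abs_lt.1 (hy j)
  have h3 : a j ≤ ∑ k, a k := Finset.single_le_sum (fun k _ => (ha k).le) (Finset.mem_univ j)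
  rw [abs_le]; constructor <;> linarith

lemma Ka_mix {N : ℕ} (a : Fin N → ℝ) {x y : Fin N → ℝ} {s : ℝ} (hs0 : 0 ≤ s) (hs1 : s ≤ 1)
    (hx : x ∈ Ka a) (hy : y ∈ Ka a) : s • y + (1 - s) • x ∈ Ka a :=
  Ka_convex a hy hx hs0 (by linarith) (by ring)

lemma indicator_meas {X Y : Type*} [TopologicalSpace X] [MeasurableSpace X] [BorelSpace X]
    [TopologicalSpace Y] [MeasurableSpace Y] [BorelSpace Y] [Zero Y]
    {f : X → Y} {K : Set X} (hK : MeasurableSet K) (hf : ContinuousOn f K) :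
    Measurable (K.indicator f) := by
  classical
  rw [← Set.piecewise_eq_indicator]
  exact hf.measurable_piecewise continuousOn_const hK

structure IsBump {N : ℕ} (a : Fin N → ℝ) (i : Fin N) (η : (Fin N → ℝ) → ℝ) (B : ℝ) : Prop where
  smooth : ContDiff ℝ 1 η
  cpt : HasCompactSupport η
  supp : tsupport η ⊆ Ka a
  nonneg : ∀ y, 0 ≤ η y
  int : ∫ y, η y = 1
  Bpos : 0 < B
  le : ∀ y, η y ≤ B
  dle : ∀ y, |fderiv ℝ η y (Pi.single i 1)| ≤ B

lemma exists_bump {N : ℕ} (a : Fin N → ℝ) (ha : ∀ i, 0 < a i) (i : Fin N) :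
    ∃ η B, IsBump a i η B := by
  obtain ⟨ρ, hρ, hball⟩ := Metric.isOpen_iff.1 (Ka_open a) 0 (Ka_zero a ha)
  let f : ContDiffBump (0 : Fin N → ℝ) := ⟨ρ / 4, ρ / 2, by positivity, by linarith⟩
  have hsm : ContDiff ℝ 1 (f.normed volume) := f.contDiff_normed
  have hcpt : HasCompactSupport (f.normed volume) := f.hasCompactSupport_normed
  have hc1 : Continuous (fun y => fderiv ℝ (f.normed volume) y (Pi.single i 1)) :=
    (hsm.continuous_fderiv (by norm_num)).clm_apply continuous_const
  have hcpt1 : HasCompactSupport (fun y => fderiv ℝ (f.normed volume) y (Pi.single i (1:ℝ))) :=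
    hcpt.fderiv_apply ℝ (Pi.single i (1:ℝ))
  obtain ⟨B1, hB1⟩ := hcpt.exists_bound_of_continuous hsm.continuous
  obtain ⟨B2, hB2⟩ := hcpt1.exists_bound_of_continuous hc1
  refine ⟨f.normed volume, max 1 (max B1 B2), hsm, hcpt, ?_, ?_, ?_, ?_, ?_, ?_⟩
  · rw [f.tsupport_normed_eq]
    refine (Metric.closedBall_subset_ball ?_).trans hball
    change ρ / 2 < ρ
    linarith
  · intro y; exact f.nonneg_normed y
  · exact f.integral_normed
  · positivity
  · intro y
    exact (le_abs_self _).trans ((hB1 y).trans ((le_max_left _ _).trans (le_max_right _ _)))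
  · intro y
    exact (hB2 y).trans ((le_max_right _ _).trans (le_max_right _ _))

lemma bump_integrable {N : ℕ} {a : Fin N → ℝ} {i : Fin N} {η : (Fin N → ℝ) → ℝ} {B : ℝ}
    (hη : IsBump a i η B) {g : (Fin N → ℝ) → ℝ} {φ : (Fin N → ℝ) → ℝ} (hφ : Continuous φ)
    (hs : tsupport φ ⊆ tsupport η) (hg : ContinuousOn g (Ka a)) :
    Integrable (fun y => φ y * g y) := by
  have hc : IsCompact (tsupport η) := hη.cpt
  have h1 : IntegrableOn (fun y => φ y * g y) (tsupport η) :=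
    ContinuousOn.integrableOn_compact hc (hφ.continuousOn.mul (hg.mono hη.supp))
  refine (integrableOn_iff_integrable_of_support_subset ?_).1 h1
  intro y hy
  apply hs
  apply subset_tsupport
  intro h
  simp [h] at hy

lemma mean_bound {N : ℕ} {a : Fin N → ℝ} (ha : ∀ i, 0 < a i) {i : Fin N} {η : (Fin N → ℝ) → ℝ}
    {B : ℝ} (hη : IsBump a i η B) {u : (Fin N → ℝ) → ℝ} (hu : ContDiffOn ℝ 1 u (Ka a)) {M : ℝ}
    (hM : ∫⁻ y in Ka a, ENNReal.ofReal (u y ^ 2) ≤ ENNReal.ofReal (M ^ 2))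
    {s κ : ℝ} (hs0 : 0 < s) (hs1 : s ≤ 1) (hκ : 0 < κ) (hκs : κ ^ 2 = (s ^ N)⁻¹)
    {x : Fin N → ℝ} (hx : x ∈ Ka a) :
    |∫ y, η y * Dop i u (s • y + (1 - s) • x)| ≤ B * (volume.real (Ka a) + M ^ 2) * κ / s := by
  set U : (Fin N → ℝ) → ℝ := fun y => u (s • y + (1 - s) • x) with hU
  have hmap : Set.MapsTo (fun y => s • y + (1 - s) • x) (Ka a) (Ka a) := fun y hy =>
    Ka_mix a hs0.le hs1 hx hy
  have hd : ∀ y ∈ Ka a, HasFDerivAt U (s • fderiv ℝ u (s • y + (1 - s) • x)) y := by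
    intro y hy
    have h1 : HasFDerivAt u (fderiv ℝ u (s • y + (1 - s) • x)) (s • y + (1 - s) • x) :=
      ((hu.differentiableOn (by norm_num)).differentiableAt
        ((Ka_open a).mem_nhds (hmap hy))).hasFDerivAt
    have h2 : HasFDerivAt (fun y : Fin N → ℝ => s • y + (1 - s) • x)
        (s • ContinuousLinearMap.id ℝ (Fin N → ℝ)) y :=
      ((hasFDerivAt_id y).const_smul s).add_const _
    have h3 : HasFDerivAt U ((fderiv ℝ u (s • y + (1 - s) • x)).comp
        (s • ContinuousLinearMap.id ℝ (Fin N → ℝ))) y := h1.comp y h2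
    have e : s • fderiv ℝ u (s • y + (1 - s) • x) = (fderiv ℝ u (s • y + (1 - s) • x)).comp
        (s • ContinuousLinearMap.id ℝ (Fin N → ℝ)) := by
      ext z; simp
    rw [e]; exact h3
  have hvc : ContinuousOn (Dop i u) (Ka a) :=
    (hu.continuousOn_fderiv_of_isOpen (Ka_open a) (by norm_num)).clm_apply continuousOn_const
  have hcm : ContinuousOn (fun y : Fin N → ℝ => s • y + (1 - s) • x) (Ka a) :=
    Continuous.continuousOn (by fun_prop)
  have hvc' : ContinuousOn (fun y => Dop i u (s • y + (1 - s) • x)) (Ka a) := hvc.comp hcm hmap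
  have hUc : ContinuousOn U (Ka a) := hu.continuousOn.comp hcm hmap
  have hcη' : Continuous (fun y => fderiv ℝ η y (Pi.single i 1)) :=
    (hη.smooth.continuous_fderiv (by norm_num)).clm_apply continuous_const
  have hsuppη' : tsupport (fun y => fderiv ℝ η y (Pi.single i (1:ℝ))) ⊆ tsupport η :=
    tsupport_fderiv_apply_subset ℝ _
  have heq : ∀ y, η y * fderiv ℝ U y (Pi.single i 1)
      = s * (η y * Dop i u (s • y + (1 - s) • x)) := by
    intro y
    by_cases hy : y ∈ Ka a
    · rw [(hd y hy).fderiv]; simp [Dop]; ring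
    · have : η y = 0 := by
        by_contra h
        exact hy (hη.supp (subset_tsupport _ h))
      simp [this]
  have I0 := bump_integrable hη hη.smooth.continuous subset_rfl hvc'
  have I1 := bump_integrable hη hcη' hsuppη' hUc
  have I2 := bump_integrable hη hη.smooth.continuous subset_rfl hUc
  have I3 : Integrable (fun y => η y * fderiv ℝ U y (Pi.single i 1)) := by
    simp_rw [heq]; exact I0.const_mul s
  have ibp := integral_mul_fderiv_eq_neg_fderiv_mul_of_integrable I1 I3 I2
    (fun y _ => (hη.smooth.differentiable (by norm_num)) y)
    (fun y hy => (hd y (hη.supp hy)).differentiableAt)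
  simp_rw [heq] at ibp
  rw [integral_const_mul] at ibp
  have hVtop := Ka_vol a ha
  -- bound on the right-hand side
  have hmeas := (Ka_open a).measurableSet
  have hG : Measurable ((Ka a).indicator (fun y => ENNReal.ofReal (u y ^ 2))) :=
    indicator_meas hmeas (ENNReal.continuous_ofReal.comp_continuousOn (hu.continuousOn.pow 2))
  have hU2 : ∫⁻ y in Ka a, ENNReal.ofReal (U y ^ 2) ≤ ENNReal.ofReal (κ ^ 2 * M ^ 2) := by
    calc ∫⁻ y in Ka a, ENNReal.ofReal (U y ^ 2)
        = ∫⁻ y in Ka a, (Ka a).indicator (fun y => ENNReal.ofReal (u y ^ 2))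
            (s • y + (1 - s) • x) := by
          apply setLIntegral_congr_fun hmeas
          intro y hy
          simp only [Set.indicator_of_mem (hmap hy), hU]
      _ ≤ ∫⁻ y, (Ka a).indicator (fun y => ENNReal.ofReal (u y ^ 2))
            (s • y + (1 - s) • x) := setLIntegral_le_lintegral _ _
      _ = ENNReal.ofReal ((s ^ N)⁻¹) * ∫⁻ y in Ka a, ENNReal.ofReal (u y ^ 2) := by
          rw [lintegral_affine _ hG s hs0, lintegral_indicator hmeas]
      _ ≤ ENNReal.ofReal ((s ^ N)⁻¹) * ENNReal.ofReal (M ^ 2) := by gcongr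
      _ = ENNReal.ofReal (κ ^ 2 * M ^ 2) := by
          rw [hκs, ENNReal.ofReal_mul (by positivity)]
  have hB := hη.Bpos
  have hlin : ENNReal.ofReal |∫ y, fderiv ℝ η y (Pi.single i 1) * U y|
      ≤ ENNReal.ofReal (B * (volume.real (Ka a) + M ^ 2) * κ) := by
    rw [← Real.enorm_eq_ofReal_abs]
    refine (enorm_integral_le_lintegral_enorm _).trans ?_
    calc ∫⁻ y, ‖fderiv ℝ η y (Pi.single i 1) * U y‖ₑ
        ≤ ∫⁻ y in Ka a, (ENNReal.ofReal (B * κ)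
            + ENNReal.ofReal (B / κ) * ENNReal.ofReal (U y ^ 2)) := by
          rw [← lintegral_indicator hmeas]
          apply lintegral_mono
          intro y
          by_cases hy : y ∈ Ka a
          · simp only [Set.indicator_of_mem hy]
            rw [← ENNReal.ofReal_mul (by positivity), ← ENNReal.ofReal_add (by positivity)
              (by positivity), Real.enorm_eq_ofReal_abs]
            apply ENNReal.ofReal_le_ofReal
            rw [abs_mul]
            have h1 := hη.dle y
            have h2 : |U y| ≤ κ + U y ^ 2 / κ := by
              rw [← sq_abs, ← sub_nonneg]
              have : κ + |U y| ^ 2 / κ - |U y| = ((κ - |U y| / 2) ^ 2 + 3 / 4 * |U y| ^ 2) / κ := by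
                field_simp; ring
              rw [this]; positivity
            calc _ ≤ B * (κ + U y ^ 2 / κ) := by gcongr
              _ = _ := by ring
          · have h0 : fderiv ℝ η y (Pi.single i 1) = 0 := by
              by_contra h
              exact hy (hη.supp (hsuppη' (subset_tsupport _ h)))
            simp [h0]
      _ = ENNReal.ofReal (B * κ) * volume (Ka a)
            + ENNReal.ofReal (B / κ) * ∫⁻ y in Ka a, ENNReal.ofReal (U y ^ 2) := by
          rw [lintegral_add_left measurable_const, lintegral_const_mul' _ _ ENNReal.ofReal_ne_top]
          simp
      _ ≤ ENNReal.ofReal (B * κ) * ENNReal.ofReal (volume.real (Ka a))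
            + ENNReal.ofReal (B / κ) * ENNReal.ofReal (κ ^ 2 * M ^ 2) := by
          rw [ofReal_measureReal hVtop.ne]
          gcongr
      _ = _ := by
          rw [← ENNReal.ofReal_mul (by positivity), ← ENNReal.ofReal_mul (by positivity),
            ← ENNReal.ofReal_add (by positivity) (by positivity)]
          congr 1
          field_simp
  have hreal := (ENNReal.ofReal_le_ofReal_iff (by positivity)).1 hlin
  rw [le_div_iff₀ hs0]
  have : |∫ y, η y * Dop i u (s • y + (1 - s) • x)| * s
      = |∫ y, fderiv ℝ η y (Pi.single i 1) * U y| := by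
    rw [← abs_neg (∫ y, fderiv ℝ η y (Pi.single i 1) * U y), ← ibp, abs_mul, abs_of_pos hs0,
      mul_comm]
  rw [this]; exact hreal

/-- weighted gradient energy density on `K_a` -/
def Hden {N : ℕ} (a : Fin N → ℝ) (b : ℝ) (v : (Fin N → ℝ) → ℝ) : (Fin N → ℝ) → ENNReal :=
  (Ka a).indicator (fun z => ENNReal.ofReal (psiT b (v z) ^ 2 * ∑ j, Dop j v z ^ 2))

lemma fderiv_sq_le {N : ℕ} (l : (Fin N → ℝ) →L[ℝ] ℝ) (w : Fin N → ℝ) {A : ℝ}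
    (hw : ∀ j, |w j| ≤ A) :
    (l w) ^ 2 ≤ N * A ^ 2 * ∑ j, (l (Pi.single j 1)) ^ 2 := by
  have h1 : l w = ∑ j, w j * l (Pi.single j 1) := by
    conv_lhs => rw [← Finset.univ_sum_single w]
    rw [map_sum]
    refine Finset.sum_congr rfl (fun j _ => ?_)
    have : (Pi.single j (w j) : Fin N → ℝ) = w j • Pi.single j (1:ℝ) := by
      rw [← Pi.single_smul]; simp
    rw [this, map_smul, smul_eq_mul]
  rw [h1]
  have h2 := Finset.sum_mul_sq_le_sq_mul_sq Finset.univ w (fun j => l (Pi.single j (1:ℝ)))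
  refine h2.trans ?_
  have h3 : ∑ j, w j ^ 2 ≤ N * A ^ 2 := by
    calc ∑ j, w j ^ 2 ≤ ∑ j : Fin N, A ^ 2 := by
          apply Finset.sum_le_sum
          intro j _
          exact sq_le_sq' (by linarith [(abs_le.1 (hw j)).1]) (abs_le.1 (hw j)).2
      _ = _ := by simp
  gcongr

lemma path_bound {N : ℕ} {a : Fin N → ℝ} (ha : ∀ i, 0 < a i) {v : (Fin N → ℝ) → ℝ}
    (hv : ContDiffOn ℝ 1 v (Ka a)) {lam s : ℝ} (hlam : 0 < lam) (hs0 : 0 < s) (hs1 : s ≤ 1)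
    {x y : Fin N → ℝ} (hx : x ∈ Ka a) (hy : y ∈ Ka a) (hvx : lam ≤ v x) :
    ENNReal.ofReal (v x / 4 - v (s • y + (1 - s) • x)) ≤
      ENNReal.ofReal (5 * (s ^ 2 * (N * (2 * ∑ k, a k) ^ 2))) *
        ∫⁻ τ in Set.Ioc (0:ℝ) 1, Hden a (lam / 8) v ((τ * s) • y + (1 - τ * s) • x) := by
  set Z : ℝ → (Fin N → ℝ) := fun τ => (τ * s) • y + (1 - τ * s) • x with hZ
  have hZK : ∀ τ ∈ Set.Icc (0:ℝ) 1, Z τ ∈ Ka a := by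
    intro τ hτ
    refine Ka_mix a (mul_nonneg hτ.1 hs0.le) ?_ hx hy
    nlinarith [hτ.1, hτ.2]
  have hZd : ∀ τ, HasDerivAt Z (s • (y - x)) τ := by
    intro τ
    have h1 : HasDerivAt (fun τ : ℝ => τ * s) s τ := by
      simpa using (hasDerivAt_id τ).mul_const s
    have h2 := (h1.smul_const y).add ((h1.const_sub 1).smul_const x)
    have e : s • (y - x) = s • y + (-s) • x := by
      rw [smul_sub, neg_smul, sub_eq_add_neg]
    rw [e]; exact h2
  have hZc : Continuous Z := by
    rw [hZ]; fun_prop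
  have hfc : ContinuousOn (fderiv ℝ v) (Ka a) :=
    hv.continuousOn_fderiv_of_isOpen (Ka_open a) (by norm_num)
  have huIcc : Set.uIcc (0:ℝ) 1 = Set.Icc 0 1 := Set.uIcc_of_le zero_le_one
  have hf'c : ContinuousOn (fun τ => fderiv ℝ v (Z τ) (s • (y - x))) (Set.uIcc (0:ℝ) 1) := by
    rw [huIcc]
    exact (hfc.comp hZc.continuousOn hZK).clm_apply continuousOn_const
  have hvd : ∀ z ∈ Ka a, HasFDerivAt v (fderiv ℝ v z) z := fun z hz =>
    ((hv.differentiableOn (by norm_num)).differentiableAt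
        ((Ka_open a).mem_nhds hz)).hasFDerivAt
  have main := oneD (fun τ => v (Z τ)) (fun τ => fderiv ℝ v (Z τ) (s • (y - x))) lam hlam
    (by
      intro τ hτ
      rw [huIcc] at hτ
      exact (hvd _ (hZK τ hτ)).comp_hasDerivAt τ (hZd τ)) hf'c (by simpa [hZ] using hvx)
  have e0 : Z 0 = x := by simp [hZ]
  have e1 : Z 1 = s • y + (1 - s) • x := by simp [hZ]
  simp only [e0, e1] at main
  set f2 : ℝ → ℝ := fun τ => (psiT (lam / 8) (v (Z τ)) * fderiv ℝ v (Z τ) (s • (y - x))) ^ 2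
    with hf2
  have hf2c : ContinuousOn f2 (Set.Icc (0:ℝ) 1) := by
    rw [← huIcc]
    refine (ContinuousOn.mul ?_ hf'c).pow 2
    refine (psiT_cont (by positivity)).comp_continuousOn ?_
    rw [huIcc]
    exact hv.continuousOn.comp hZc.continuousOn hZK
  have hI : IntegrableOn f2 (Set.Ioc (0:ℝ) 1) :=
    (hf2c.integrableOn_compact isCompact_Icc).mono_set Set.Ioc_subset_Icc_self
  rw [intervalIntegral.integral_of_le zero_le_one] at main
  refine (ENNReal.ofReal_le_ofReal main).trans ?_
  rw [ENNReal.ofReal_mul (by norm_num), ofReal_integral_eq_lintegral_ofReal hI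
    (Filter.Eventually.of_forall (fun τ => sq_nonneg _)), ENNReal.ofReal_mul (by norm_num),
    mul_assoc]
  refine mul_le_mul_right ?_ _
  rw [← lintegral_const_mul' _ _ ENNReal.ofReal_ne_top]
  apply setLIntegral_mono' measurableSet_Ioc
  intro τ hτ
  have hz := hZK τ (Set.Ioc_subset_Icc_self hτ)
  rw [Hden, Set.indicator_of_mem hz, ← ENNReal.ofReal_mul (by positivity)]
  apply ENNReal.ofReal_le_ofReal
  rw [hf2]
  have h5 := fderiv_sq_le (fderiv ℝ v (Z τ)) (y - x) (A := 2 * ∑ k, a k)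
    (fun j => Ka_diff a ha hx hy j)
  have : (psiT (lam / 8) (v (Z τ)) * fderiv ℝ v (Z τ) (s • (y - x))) ^ 2
      = s ^ 2 * psiT (lam / 8) (v (Z τ)) ^ 2 * (fderiv ℝ v (Z τ) (y - x)) ^ 2 := by
    rw [map_smul, smul_eq_mul]; ring
  simp only [this]
  calc s ^ 2 * psiT (lam / 8) (v (Z τ)) ^ 2 * (fderiv ℝ v (Z τ) (y - x)) ^ 2
      ≤ s ^ 2 * psiT (lam / 8) (v (Z τ)) ^ 2 * (N * (2 * ∑ k, a k) ^ 2
          * ∑ j, (fderiv ℝ v (Z τ) (Pi.single j 1)) ^ 2) := by gcongr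
    _ = _ := by simp only [Dop, hZ]; ring

lemma point_bound_pos {N : ℕ} {a : Fin N → ℝ} (ha : ∀ i, 0 < a i) {i : Fin N}
    {η : (Fin N → ℝ) → ℝ} {B : ℝ} (hη : IsBump a i η B) {v : (Fin N → ℝ) → ℝ}
    (hv : ContDiffOn ℝ 1 v (Ka a)) {lam s : ℝ} (hlam : 0 < lam) (hs0 : 0 < s) (hs1 : s ≤ 1)
    {x : Fin N → ℝ} (hx : x ∈ Ka a) (hvx : lam ≤ v x)
    (hmean : ∫ y, η y * v (s • y + (1 - s) • x) ≤ lam / 8) :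
    ENNReal.ofReal (lam / 8) ≤
      ENNReal.ofReal (B * (5 * (s ^ 2 * (N * (2 * ∑ k, a k) ^ 2)))) *
        ∫⁻ y in Ka a, ∫⁻ τ in Set.Ioc (0:ℝ) 1,
          Hden a (lam / 8) v ((τ * s) • y + (1 - τ * s) • x) := by
  have hmap : Set.MapsTo (fun y => s • y + (1 - s) • x) (Ka a) (Ka a) := fun y hy =>
    Ka_mix a hs0.le hs1 hx hy
  have hvc' : ContinuousOn (fun y => v (s • y + (1 - s) • x)) (Ka a) :=
    hv.continuousOn.comp (Continuous.continuousOn (by fun_prop)) hmap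
  have I0 := bump_integrable hη hη.smooth.continuous subset_rfl hvc'
  have I1 : Integrable η := hη.smooth.continuous.integrable_of_hasCompactSupport hη.cpt
  have e : ∫ y, η y * (v x / 4 - v (s • y + (1 - s) • x))
      = v x / 4 - ∫ y, η y * v (s • y + (1 - s) • x) := by
    simp_rw [mul_sub]
    rw [integral_sub (I1.mul_const _) I0, integral_mul_const, hη.int, one_mul]
  have hI : Integrable (fun y => η y * (v x / 4 - v (s • y + (1 - s) • x))) := by
    simp_rw [mul_sub]
    exact (I1.mul_const _).sub I0
  have hle : lam / 8 ≤ ∫ y, η y * (v x / 4 - v (s • y + (1 - s) • x)) := by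
    rw [e]; linarith
  refine (ENNReal.ofReal_le_ofReal hle).trans ((ofReal_integral_le' hI).trans ?_)
  have hB := hη.Bpos
  rw [← lintegral_const_mul' _ _ ENNReal.ofReal_ne_top,
    ← lintegral_indicator (Ka_open a).measurableSet]
  apply lintegral_mono
  intro y
  by_cases hy : y ∈ Ka a
  · simp only [Set.indicator_of_mem hy]
    rw [ENNReal.ofReal_mul (hη.nonneg y), ENNReal.ofReal_mul hB.le, mul_assoc]
    gcongr
    · exact hη.le y
    · exact path_bound ha hv hlam hs0 hs1 hx hy hvx
  · have : η y = 0 := by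
      by_contra h
      exact hy (hη.supp (subset_tsupport _ h))
    simp [this]

lemma Hden_neg {N : ℕ} (a : Fin N → ℝ) (b : ℝ) (v : (Fin N → ℝ) → ℝ) :
    Hden a b (fun z => - v z) = Hden a b v := by
  unfold Hden
  congr 1
  ext z
  simp [psiT, Dop, fderiv_fun_neg]

lemma point_bound {N : ℕ} {a : Fin N → ℝ} (ha : ∀ i, 0 < a i) {i : Fin N}
    {η : (Fin N → ℝ) → ℝ} {B : ℝ} (hη : IsBump a i η B) {v : (Fin N → ℝ) → ℝ}
    (hv : ContDiffOn ℝ 1 v (Ka a)) {lam s : ℝ} (hlam : 0 < lam) (hs0 : 0 < s) (hs1 : s ≤ 1)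
    {x : Fin N → ℝ} (hx : x ∈ Ka a) (hvx : lam ≤ |v x|)
    (hmean : |∫ y, η y * v (s • y + (1 - s) • x)| ≤ lam / 8) :
    ENNReal.ofReal (lam / 8) ≤
      ENNReal.ofReal (B * (5 * (s ^ 2 * (N * (2 * ∑ k, a k) ^ 2)))) *
        ∫⁻ y in Ka a, ∫⁻ τ in Set.Ioc (0:ℝ) 1,
          Hden a (lam / 8) v ((τ * s) • y + (1 - τ * s) • x) := by
  rcases le_abs.1 hvx with h | h
  · exact point_bound_pos ha hη hv hlam hs0 hs1 hx h (abs_le.1 hmean).2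
  · rw [← Hden_neg]
    refine point_bound_pos ha hη hv.neg hlam hs0 hs1 hx h ?_
    simp_rw [mul_neg]
    rw [integral_neg]
    linarith [(abs_le.1 hmean).1]

/-- left-hand integrand -/
def Fden (r ε P v : ℝ) : ℝ := (ε ^ 2 + v ^ 2) ^ ((P + r - 2) / 2) * v ^ 2

/-- right-hand weight -/
def wden (ε P v : ℝ) : ℝ := (ε ^ 2 + v ^ 2) ^ ((P - 2) / 2)

lemma Fden_le {r ε P v R : ℝ} (hε : 0 < ε) (hε1 : ε < 1) (hP : 0 ≤ P + r) (hR : 1 ≤ R)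
    (hv : |v| < R) : Fden r ε P v ≤ (2 * R) ^ (P + r) := by
  have hβ : 0 < ε ^ 2 + v ^ 2 := by positivity
  have h1 : Fden r ε P v ≤ (ε ^ 2 + v ^ 2) ^ ((P + r) / 2) := by
    unfold Fden
    calc (ε ^ 2 + v ^ 2) ^ ((P + r - 2) / 2) * v ^ 2
        ≤ (ε ^ 2 + v ^ 2) ^ ((P + r - 2) / 2) * (ε ^ 2 + v ^ 2) := by
          gcongr; nlinarith
      _ = (ε ^ 2 + v ^ 2) ^ ((P + r) / 2) := by
          rw [← Real.rpow_add_one hβ.ne']; congr 1; ring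
  refine h1.trans ?_
  have h2 : ε ^ 2 + v ^ 2 ≤ (2 * R) ^ (2:ℝ) := by
    rw [Real.rpow_two, ← sq_abs v]
    nlinarith [abs_nonneg v]
  calc (ε ^ 2 + v ^ 2) ^ ((P + r) / 2) ≤ ((2 * R) ^ (2:ℝ)) ^ ((P + r) / 2) := by
        apply Real.rpow_le_rpow hβ.le h2; linarith
    _ = (2 * R) ^ (P + r) := by
        rw [← Real.rpow_mul (by positivity)]; congr 1; ring

lemma wden_ge {ε P v : ℝ} (hε1 : ε < 1) (hε : 0 < ε) (hP : 1 ≤ P) (hv : 1 ≤ |v|) :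
    |v| ^ (P - 2) ≤ 2 * wden ε P v := by
  unfold wden
  have hv0 : 0 < |v| := by linarith
  have e : |v| ^ (P - 2) = (v ^ 2) ^ ((P - 2) / 2) := by
    rw [← sq_abs v, ← Real.rpow_two, ← Real.rpow_mul (abs_nonneg v)]; congr 1; ring
  have hv2 : 1 ≤ v ^ 2 := by rw [← sq_abs]; nlinarith
  have hβ : 0 < ε ^ 2 + v ^ 2 := by positivity
  rw [e]
  rcases le_total 2 P with h | h
  · have : (v ^ 2) ^ ((P - 2) / 2) ≤ (ε ^ 2 + v ^ 2) ^ ((P - 2) / 2) := by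
      apply Real.rpow_le_rpow (by positivity) (by nlinarith) (by linarith)
    have h0 : 0 ≤ (ε ^ 2 + v ^ 2) ^ ((P - 2) / 2) := by positivity
    linarith
  · have h1 : (2 * v ^ 2) ^ ((P - 2) / 2) ≤ (ε ^ 2 + v ^ 2) ^ ((P - 2) / 2) := by
      apply Real.rpow_le_rpow_of_nonpos hβ (by nlinarith) (by linarith)
    rw [Real.mul_rpow (by norm_num) (by positivity)] at h1
    have h2 : (2:ℝ)⁻¹ ≤ 2 ^ ((P - 2) / 2) := by
      rw [← Real.rpow_neg_one]
      apply Real.rpow_le_rpow_of_exponent_le (by norm_num) (by linarith)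
    have h3 : 0 ≤ (v ^ 2) ^ ((P - 2) / 2) := by positivity
    nlinarith

lemma weight_compare {ε Px Pz Pm lam v C1 S κ : ℝ} (hε1 : ε < 1) (hε : 0 < ε) (hPz : 1 ≤ Pz)
    (hPm : Pz ≤ Pm) (hlam : 8 ≤ lam) (hκ : |Px - Pz| ≤ κ) (hC1 : lam ^ κ ≤ C1) (hS : 0 ≤ S) :
    lam ^ (Px - 1) * (psiT (lam / 8) v ^ 2 * S) ≤ (2 * C1 * 8 ^ Pm) * (wden ε Pz v * S) := by
  have hlam0 : 0 < lam := by linarith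
  have hw0 : 0 ≤ wden ε Pz v := by unfold wden; positivity
  have hC0 : 0 ≤ C1 := le_trans (by positivity) hC1
  rcases le_total |v| (lam / 8) with h | h
  · rw [psiT_zero (by positivity) h]
    have : 0 ≤ (2 * C1 * 8 ^ Pm) * (wden ε Pz v * S) := by positivity
    simpa using this
  · have hv1 : 1 ≤ |v| := by linarith
    have hv0 : 0 < |v| := by linarith
    have a1 := psiT_sq_le (by positivity : 0 < lam / 8) h
    have a2 : lam ^ (Px - 1) ≤ C1 * lam ^ (Pz - 1) := by
      calc lam ^ (Px - 1) = lam ^ (Px - Pz) * lam ^ (Pz - 1) := by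
            rw [← Real.rpow_add hlam0]; congr 1; ring
        _ ≤ C1 * lam ^ (Pz - 1) := by
            gcongr
            refine le_trans ?_ hC1
            exact Real.rpow_le_rpow_of_exponent_le (by linarith) ((le_abs_self _).trans hκ)
    have a3 : lam ^ (Pz - 1) ≤ 8 ^ Pm * |v| ^ (Pz - 1) := by
      calc lam ^ (Pz - 1) ≤ (8 * |v|) ^ (Pz - 1) :=
            Real.rpow_le_rpow hlam0.le (by linarith) (by linarith)
        _ = 8 ^ (Pz - 1) * |v| ^ (Pz - 1) := Real.mul_rpow (by norm_num) hv0.le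
        _ ≤ 8 ^ Pm * |v| ^ (Pz - 1) := by
            gcongr
            · norm_num
            · linarith
    have a4 : |v| ^ (Pz - 1) * (1 / |v|) = |v| ^ (Pz - 2) := by
      rw [mul_one_div, ← Real.rpow_sub_one hv0.ne']; congr 1; ring
    have a5 := wden_ge hε1 hε hPz hv1
    calc lam ^ (Px - 1) * (psiT (lam / 8) v ^ 2 * S)
        ≤ (C1 * (8 ^ Pm * |v| ^ (Pz - 1))) * ((1 / |v|) * S) := by
          gcongr
          exact a2.trans (by gcongr)
      _ = C1 * 8 ^ Pm * (|v| ^ (Pz - 1) * (1 / |v|)) * S := by ring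
      _ ≤ C1 * 8 ^ Pm * (2 * wden ε Pz v) * S := by rw [a4]; gcongr
      _ = _ := by ring

/-- right-hand energy density as an `ENNReal`-valued function -/
def Gden {N : ℕ} (a : Fin N → ℝ) (ε : ℝ) (P v : (Fin N → ℝ) → ℝ) : (Fin N → ℝ) → ENNReal :=
  (Ka a).indicator (fun z => ENNReal.ofReal (wden ε (P z) (v z) * ∑ j, Dop j v z ^ 2))

lemma Gden_meas {N : ℕ} {a : Fin N → ℝ} {ε : ℝ} (hε : 0 < ε) {P v : (Fin N → ℝ) → ℝ}
    (hv : ContDiffOn ℝ 1 v (Ka a)) (hP : ContinuousOn P (Ka a)) : Measurable (Gden a ε P v) := by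
  apply indicator_meas (Ka_open a).measurableSet
  apply ENNReal.continuous_ofReal.comp_continuousOn
  have hfc : ContinuousOn (fderiv ℝ v) (Ka a) :=
    hv.continuousOn_fderiv_of_isOpen (Ka_open a) (by norm_num)
  refine ContinuousOn.mul ?_ ?_
  · unfold wden
    refine ContinuousOn.rpow ((hv.continuousOn.pow 2).const_add _)
      ((hP.sub continuousOn_const).div_const _) ?_
    intro z _
    left
    positivity
  · refine continuousOn_finsetSum _ (fun j _ => ?_)
    exact (hfc.clm_apply continuousOn_const).pow 2

lemma fubini_bound {N : ℕ} {a : Fin N → ℝ} {s : ℝ} (hs0 : 0 < s) (hs1 : s ≤ 1 / 2)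
    (G : (Fin N → ℝ) → ENNReal) (hG : Measurable G) :
    ∫⁻ x in Ka a, ∫⁻ y in Ka a, ∫⁻ τ in Set.Ioc (0:ℝ) 1, G ((τ * s) • y + (1 - τ * s) • x)
      ≤ ENNReal.ofReal (2 ^ N) * volume (Ka a) * ∫⁻ z, G z := by
  have hm : Measurable (fun q : ((Fin N → ℝ) × (Fin N → ℝ)) × ℝ =>
      G ((q.2 * s) • q.1.2 + (1 - q.2 * s) • q.1.1)) := by
    apply hG.comp
    apply Continuous.measurable
    fun_prop
  rw [lintegral_lintegral_swap (by
    apply Measurable.aemeasurable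
    exact hm.lintegral_prod_right')]
  have inner : ∀ y, ∫⁻ x in Ka a, ∫⁻ τ in Set.Ioc (0:ℝ) 1, G ((τ * s) • y + (1 - τ * s) • x)
      ≤ ENNReal.ofReal (2 ^ N) * ∫⁻ z, G z := by
    intro y
    rw [lintegral_lintegral_swap (by
      apply Measurable.aemeasurable
      apply hG.comp
      apply Continuous.measurable
      fun_prop)]
    have hτ : ∀ τ ∈ Set.Ioc (0:ℝ) 1, ∫⁻ x in Ka a, G ((τ * s) • y + (1 - τ * s) • x)
        ≤ ENNReal.ofReal (2 ^ N) * ∫⁻ z, G z := by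
      intro τ hτ
      have h1 : 1 / 2 ≤ 1 - τ * s := by nlinarith [hτ.1, hτ.2]
      refine (setLIntegral_le_lintegral _ _).trans ?_
      simp_rw [add_comm ((τ * s) • y)]
      rw [lintegral_affine G hG _ (by linarith)]
      gcongr
      calc ((1 - τ * s) ^ N)⁻¹ ≤ ((1 / 2) ^ N)⁻¹ := by gcongr
        _ = 2 ^ N := by rw [one_div, inv_pow, inv_inv]
    refine (setLIntegral_mono' measurableSet_Ioc hτ).trans ?_
    simp
  refine (lintegral_mono inner).trans ?_
  simp [mul_comm, mul_assoc, mul_left_comm]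

lemma layer_bound {N : ℕ} {a : Fin N → ℝ} (ha : ∀ i, 0 < a i) {i : Fin N}
    {η : (Fin N → ℝ) → ℝ} {B : ℝ} (hη : IsBump a i η B) {v : (Fin N → ℝ) → ℝ}
    (hv : ContDiffOn ℝ 1 v (Ka a)) {lam s : ℝ} (hlam : 8 ≤ lam) (hs0 : 0 < s) (hs1 : s ≤ 1 / 2)
    {ε r Pm L C1 : ℝ} (hε : 0 < ε) (hε1 : ε < 1) (hr : 0 ≤ r) {P : (Fin N → ℝ) → ℝ}
    (hP1 : ∀ x ∈ Ka a, 1 ≤ P x) (hPm : ∀ x ∈ Ka a, P x ≤ Pm) (hL : 0 ≤ L)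
    (hPL : ∀ x ∈ Ka a, ∀ y ∈ Ka a, |P x - P y| ≤ L * Real.sqrt (∑ j, (x j - y j) ^ 2))
    (hPc : ContinuousOn P (Ka a))
    (hC1 : lam ^ (L * (s * (N * (2 * ∑ k, a k)))) ≤ C1)
    (hmean : ∀ x ∈ Ka a, |∫ y, η y * v (s • y + (1 - s) • x)| ≤ lam / 8) :
    ∫⁻ x in {x | x ∈ Ka a ∧ lam ≤ |v x| ∧ |v x| < 2 * lam}, ENNReal.ofReal (Fden r ε (P x) (v x))
      ≤ ENNReal.ofReal ((4 ^ (Pm + r) * 8 * (B * (5 * (N * (2 * ∑ k, a k) ^ 2)))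
          * (2 * C1 * 8 ^ Pm) * (2 ^ N * volume.real (Ka a))) * (lam ^ r * s ^ 2)) *
        ∫⁻ z, Gden a ε P v z := by
  have hlam0 : 0 < lam := by linarith
  have hB := hη.Bpos
  have hC0 : 0 ≤ C1 := le_trans (by positivity) hC1
  have hA : 0 ≤ 2 * ∑ k, a k := mul_nonneg (by norm_num) (Finset.sum_nonneg fun k _ => (ha k).le)
  set A := 2 * ∑ k, a k with hAdef
  set K1 : ℝ := 4 ^ (Pm + r) * 8 * lam ^ r * (B * (5 * (s ^ 2 * (N * A ^ 2)))) with hK1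
  have hK1n : 0 ≤ K1 := by positivity
  have hpt : ∀ x ∈ {x | x ∈ Ka a ∧ lam ≤ |v x| ∧ |v x| < 2 * lam},
      ENNReal.ofReal (Fden r ε (P x) (v x)) ≤ ENNReal.ofReal (K1 * (2 * C1 * 8 ^ Pm)) *
        ∫⁻ y in Ka a, ∫⁻ τ in Set.Ioc (0:ℝ) 1, Gden a ε P v ((τ * s) • y + (1 - τ * s) • x) := by
    rintro x ⟨hx, hx1, hx2⟩
    have hp1 := hP1 x hx
    have b1 : Fden r ε (P x) (v x) ≤ (4 ^ (Pm + r) * 8 * lam ^ r * lam ^ (P x - 1)) * (lam / 8) := by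
      calc Fden r ε (P x) (v x) ≤ (2 * (2 * lam)) ^ (P x + r) :=
            Fden_le hε hε1 (by linarith) (by linarith) hx2
        _ = 4 ^ (P x + r) * lam ^ (P x + r) := by
            rw [← Real.mul_rpow (by norm_num) hlam0.le]; congr 1; ring
        _ ≤ 4 ^ (Pm + r) * lam ^ (P x + r) := by
            gcongr
            · norm_num
            · exact hPm x hx
        _ = _ := by
            have : lam ^ (P x + r) = lam ^ r * lam ^ (P x - 1) * lam := by
              rw [mul_assoc, ← Real.rpow_add_one hlam0.ne', ← Real.rpow_add hlam0]
              congr 1; ring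
            rw [this]; ring
    have b2 := point_bound ha hη hv hlam0 hs0 (by linarith) hx hx1 (hmean x hx)
    have b3 : ENNReal.ofReal (lam ^ (P x - 1)) *
        (∫⁻ y in Ka a, ∫⁻ τ in Set.Ioc (0:ℝ) 1,
          Hden a (lam / 8) v ((τ * s) • y + (1 - τ * s) • x))
        ≤ ENNReal.ofReal (2 * C1 * 8 ^ Pm) *
        ∫⁻ y in Ka a, ∫⁻ τ in Set.Ioc (0:ℝ) 1, Gden a ε P v ((τ * s) • y + (1 - τ * s) • x) := by
      rw [← lintegral_const_mul' _ _ ENNReal.ofReal_ne_top,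
        ← lintegral_const_mul' _ _ ENNReal.ofReal_ne_top]
      apply setLIntegral_mono' (Ka_open a).measurableSet
      intro y hy
      rw [← lintegral_const_mul' _ _ ENNReal.ofReal_ne_top,
        ← lintegral_const_mul' _ _ ENNReal.ofReal_ne_top]
      apply setLIntegral_mono' measurableSet_Ioc
      intro τ hτ
      have ht0 : 0 ≤ τ * s := mul_nonneg hτ.1.le hs0.le
      have ht1 : τ * s ≤ s := by nlinarith [hτ.2]
      have hz : (τ * s) • y + (1 - τ * s) • x ∈ Ka a := Ka_mix a ht0 (by linarith) hx hy
      set z := (τ * s) • y + (1 - τ * s) • x with hzdef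
      rw [Hden, Gden, Set.indicator_of_mem hz, Set.indicator_of_mem hz,
        ← ENNReal.ofReal_mul (by positivity), ← ENNReal.ofReal_mul (by positivity)]
      apply ENNReal.ofReal_le_ofReal
      refine weight_compare hε1 hε (hP1 z hz) (hPm z hz) hlam ?_ hC1
        (Finset.sum_nonneg fun j _ => sq_nonneg _)
      refine (hPL x hx z hz).trans ?_
      gcongr
      apply Real.sqrt_le_iff.2 ⟨by positivity, ?_⟩
      have hj : ∀ j, (x j - z j) ^ 2 ≤ (s * A) ^ 2 := by
        intro j
        have e : x j - z j = -((τ * s) * (y j - x j)) := by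
          simp [hzdef]; ring
        rw [e, neg_sq, ← sq_abs, abs_mul, abs_of_nonneg ht0]
        have := Ka_diff a ha hx hy j
        gcongr
      calc ∑ j, (x j - z j) ^ 2 ≤ ∑ j : Fin N, (s * A) ^ 2 := Finset.sum_le_sum fun j _ => hj j
        _ = N * (s * A) ^ 2 := by simp
        _ ≤ (N:ℝ) ^ 2 * (s * A) ^ 2 := by
            gcongr
            exact_mod_cast Nat.le_self_pow (by norm_num) N
        _ = _ := by ring
    calc ENNReal.ofReal (Fden r ε (P x) (v x))
        ≤ ENNReal.ofReal ((4 ^ (Pm + r) * 8 * lam ^ r * lam ^ (P x - 1)) * (lam / 8)) :=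
          ENNReal.ofReal_le_ofReal b1
      _ = ENNReal.ofReal (4 ^ (Pm + r) * 8 * lam ^ r) * ENNReal.ofReal (lam ^ (P x - 1))
            * ENNReal.ofReal (lam / 8) := by
          rw [ENNReal.ofReal_mul (by positivity), ENNReal.ofReal_mul (by positivity)]
      _ ≤ ENNReal.ofReal (4 ^ (Pm + r) * 8 * lam ^ r) * ENNReal.ofReal (lam ^ (P x - 1))
            * (ENNReal.ofReal (B * (5 * (s ^ 2 * (N * A ^ 2)))) *
        ∫⁻ y in Ka a, ∫⁻ τ in Set.Ioc (0:ℝ) 1,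
          Hden a (lam / 8) v ((τ * s) • y + (1 - τ * s) • x)) := by gcongr
      _ = ENNReal.ofReal K1 * (ENNReal.ofReal (lam ^ (P x - 1)) *
        ∫⁻ y in Ka a, ∫⁻ τ in Set.Ioc (0:ℝ) 1,
          Hden a (lam / 8) v ((τ * s) • y + (1 - τ * s) • x)) := by
          rw [hK1, ENNReal.ofReal_mul (p := 4 ^ (Pm + r) * 8 * lam ^ r) (by positivity)]
          ring
      _ ≤ ENNReal.ofReal K1 * (ENNReal.ofReal (2 * C1 * 8 ^ Pm) *
        ∫⁻ y in Ka a, ∫⁻ τ in Set.Ioc (0:ℝ) 1,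
          Gden a ε P v ((τ * s) • y + (1 - τ * s) • x)) := by gcongr
      _ = _ := by rw [← mul_assoc, ENNReal.ofReal_mul hK1n]
  have hmeasG := Gden_meas hε hv hPc
  have hsetm : MeasurableSet {x | x ∈ Ka a ∧ lam ≤ |v x| ∧ |v x| < 2 * lam} := by
    have hmv : Measurable ((Ka a).indicator v) :=
      indicator_meas (Ka_open a).measurableSet hv.continuousOn
    have : {x | x ∈ Ka a ∧ lam ≤ |v x| ∧ |v x| < 2 * lam} = Ka a ∩
        ((fun x => |(Ka a).indicator v x|) ⁻¹' Set.Ico lam (2 * lam)) := by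
      ext x
      constructor
      · rintro ⟨h1, h2⟩
        exact ⟨h1, by simpa [h1] using h2⟩
      · rintro ⟨h1, h2⟩
        exact ⟨h1, by simpa [h1] using h2⟩
    rw [this]
    exact (Ka_open a).measurableSet.inter ((continuous_abs.measurable.comp hmv) measurableSet_Ico)
  refine (setLIntegral_mono' hsetm hpt).trans ?_
  rw [lintegral_const_mul' _ _ ENNReal.ofReal_ne_top]
  have hVtop := Ka_vol a ha
  calc _ ≤ ENNReal.ofReal (K1 * (2 * C1 * 8 ^ Pm)) *
        ∫⁻ x in Ka a, ∫⁻ y in Ka a, ∫⁻ τ in Set.Ioc (0:ℝ) 1,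
          Gden a ε P v ((τ * s) • y + (1 - τ * s) • x) := by
        gcongr
        exact fun x hx => hx.1
    _ ≤ ENNReal.ofReal (K1 * (2 * C1 * 8 ^ Pm)) *
        (ENNReal.ofReal (2 ^ N) * volume (Ka a) * ∫⁻ z, Gden a ε P v z) := by
        gcongr
        exact fubini_bound hs0 hs1 _ hmeasG
    _ = _ := by
        rw [← ofReal_measureReal hVtop.ne, ← ENNReal.ofReal_mul (by positivity), ← mul_assoc,
          ← ENNReal.ofReal_mul (by positivity)]
        congr 2
        rw [hK1]; ring

lemma slice {N : ℕ} {a : Fin N → ℝ} (ha : ∀ i, 0 < a i) (i : Fin N) {r δ M Pm L : ℝ}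
    (hr0 : 0 ≤ r) (hr : r < 4 / (N + 2)) (hδ : 0 < δ) (hM : 0 < M) (hL : 0 ≤ L) :
    ∃ C : ℝ, 0 ≤ C ∧ ∀ ε ∈ Set.Ioo (0:ℝ) 1, ∀ u P : (Fin N → ℝ) → ℝ,
      ContDiffOn ℝ 2 u (Ka a) →
      (∫⁻ y in Ka a, ENNReal.ofReal (u y ^ 2) ≤ ENNReal.ofReal (M ^ 2)) →
      (∀ x ∈ Ka a, 1 ≤ P x) → (∀ x ∈ Ka a, P x ≤ Pm) →
      (∀ x ∈ Ka a, ∀ y ∈ Ka a, |P x - P y| ≤ L * Real.sqrt (∑ j, (x j - y j) ^ 2)) →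
      ContinuousOn P (Ka a) →
      IntegrableOn (fun x => wden ε (P x) (Dop i u x) * ∑ j, Dop j (Dop i u) x ^ 2) (Ka a) →
      ∫ x in Ka a, Fden r ε (P x) (Dop i u x)
        ≤ δ * (∫ x in Ka a, wden ε (P x) (Dop i u x) * ∑ j, Dop j (Dop i u) x ^ 2) + C := by
  obtain ⟨η, B, hη⟩ := exists_bump a ha i
  have hB := hη.Bpos
  have hVtop := Ka_vol a ha
  set V := volume.real (Ka a) with hV
  have hV0 : 0 ≤ V := measureReal_nonneg
  set A := 2 * ∑ k, a k with hA
  have hA0 : 0 ≤ A := mul_nonneg (by norm_num) (Finset.sum_nonneg fun k _ => (ha k).le)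
  set e : ℝ := 2 / (N + 2) with he
  have he0 : 0 < e := by positivity
  set W : ℝ := 8 * (B * (V + M ^ 2)) with hW
  have hW0 : 0 < W := by positivity
  set γ : ℝ := 2 * e - r with hγ
  have hγ0 : 0 < γ := by
    have : 2 * e = 4 / (N + 2) := by rw [he]; ring
    rw [hγ, this]; linarith
  set C1 : ℝ := Real.exp (L * N * A * W ^ e / e) with hC1
  set C4 : ℝ := (4 ^ (Pm + r) * 8 * (B * (5 * (N * A ^ 2)))
          * (2 * C1 * 8 ^ Pm) * (2 ^ N * V)) with hC4
  have hC40 : 0 ≤ C4 := by positivity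
  set D : ℝ := C4 * W ^ (2 * e) with hD
  have hD0 : 0 ≤ D := by positivity
  set q : ℝ := 2 ^ (-γ) with hq
  have hq0 : 0 < q := by positivity
  have hq1 : q < 1 := Real.rpow_lt_one_of_one_lt_of_neg (by norm_num) (by linarith)
  -- choice of the threshold
  have ht2 : Filter.Tendsto (fun k : ℕ => (2:ℝ) ^ k) Filter.atTop Filter.atTop :=
    tendsto_pow_atTop_atTop_of_one_lt (by norm_num)
  have htq : Filter.Tendsto (fun k : ℕ => D * q ^ k * (1 - q)⁻¹) Filter.atTop (nhds 0) := by
    have := ((tendsto_pow_atTop_nhds_zero_of_lt_one hq0.le hq1).const_mul D).mul_const (1 - q)⁻¹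
    simpa using this
  obtain ⟨k0, hk8, hkW, hkδ⟩ := ((ht2.eventually_ge_atTop 8).and
    ((ht2.eventually_ge_atTop (W / (1 / 2) ^ (1 / e))).and (htq.eventually_le_const hδ))).exists
  refine ⟨(2 * 2 ^ k0) ^ (Pm + r) * V, by positivity, ?_⟩
  rintro ε ⟨hε, hε1⟩ u P hu hu2 hP1 hPm hPL hPc hint
  set v := Dop i u with hv
  have hvC : ContDiffOn ℝ 1 v (Ka a) := by
    have h1 : ContDiffOn ℝ 1 (fderiv ℝ u) (Ka a) :=
      hu.fderiv_of_isOpen (Ka_open a) (by norm_num)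
    exact h1.clm_apply contDiffOn_const
  have hlayer : ∀ n : ℕ, ∫⁻ x in {x | x ∈ Ka a ∧ (2:ℝ) ^ (k0 + n) ≤ |v x| ∧
        |v x| < 2 * 2 ^ (k0 + n)}, ENNReal.ofReal (Fden r ε (P x) (v x))
      ≤ ENNReal.ofReal (D * q ^ k0 * q ^ n) * ∫⁻ z, Gden a ε P v z := by
    intro n
    set lam : ℝ := 2 ^ (k0 + n) with hlam
    have hle : (2:ℝ) ^ k0 ≤ lam := pow_le_pow_right₀ (by norm_num) (by omega)
    have hlam8 : 8 ≤ lam := hk8.trans hle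
    have hlam0 : 0 < lam := by linarith
    set s : ℝ := (W / lam) ^ e with hs
    have hs0 : 0 < s := by positivity
    have hs1 : s ≤ 1 / 2 := by
      have h1 : W / lam ≤ (1 / 2) ^ (1 / e) := by
        rw [div_le_iff₀ hlam0]
        have := hkW.trans hle
        rw [div_le_iff₀ (by positivity)] at this
        linarith
      calc s ≤ ((1 / 2) ^ (1 / e)) ^ e := Real.rpow_le_rpow (by positivity) h1 he0.le
        _ = 1 / 2 := by
          rw [← Real.rpow_mul (by norm_num), one_div_mul_cancel he0.ne', Real.rpow_one]
    have hc1 : lam ^ (L * (s * (N * A))) ≤ C1 := by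
      rw [Real.rpow_def_of_pos hlam0, hC1]
      apply Real.exp_le_exp.2
      have hlog := Real.log_le_rpow_div hlam0.le he0
      calc Real.log lam * (L * (s * (N * A))) ≤ lam ^ e / e * (L * (s * (N * A))) := by gcongr
        _ = L * N * A * (s * lam ^ e) / e := by ring
        _ = L * N * A * W ^ e / e := by
          rw [hs, ← Real.mul_rpow (by positivity) hlam0.le, div_mul_cancel₀ _ hlam0.ne']
    have hκs : (s ^ (-(N:ℝ) / 2)) ^ 2 = (s ^ N)⁻¹ := by
      rw [← Real.rpow_natCast s N, ← Real.rpow_neg hs0.le, ← Real.rpow_two,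
        ← Real.rpow_mul hs0.le]
      congr 1; ring
    have hmean : ∀ x ∈ Ka a, |∫ y, η y * v (s • y + (1 - s) • x)| ≤ lam / 8 := by
      intro x hx
      refine (mean_bound ha hη (hu.of_le (by norm_num)) hu2 hs0 (by linarith)
        (by positivity) hκs hx).trans ?_
      have h1 : s ^ (-(N:ℝ) / 2) / s = lam / W := by
        rw [← Real.rpow_sub_one hs0.ne', hs, ← Real.rpow_mul (by positivity)]
        have : e * (-(N:ℝ) / 2 - 1) = -1 := by
          rw [he]; field_simp; ring
        rw [this, Real.rpow_neg_one, inv_div]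
      rw [mul_div_assoc, h1, ← hV]
      apply le_of_eq
      rw [hW]
      field_simp
    have main := layer_bound ha hη hvC hlam8 hs0 hs1 hε hε1 hr0 hP1 hPm hL hPL hPc hc1 hmean
    refine main.trans (le_of_eq ?_)
    congr 2
    change C4 * (lam ^ r * s ^ 2) = _
    have h1 : s ^ 2 = W ^ (2 * e) * lam ^ (-(2 * e)) := by
      rw [hs, ← Real.rpow_two, ← Real.rpow_mul (by positivity), Real.div_rpow hW0.le hlam0.le,
        Real.rpow_neg hlam0.le, mul_comm e 2, div_eq_mul_inv]
    have h2 : lam ^ r * lam ^ (-(2 * e)) = q ^ k0 * q ^ n := by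
      rw [← Real.rpow_add hlam0, ← pow_add, hq, hlam, ← Real.rpow_natCast (2:ℝ) (k0 + n),
        ← Real.rpow_mul (by norm_num), ← Real.rpow_natCast (_ ^ _) (k0 + n),
        ← Real.rpow_mul (by norm_num)]
      congr 1; rw [hγ]; ring
    rw [h1]
    calc C4 * (lam ^ r * (W ^ (2 * e) * lam ^ (-(2 * e))))
        = D * (lam ^ r * lam ^ (-(2 * e))) := by rw [hD]; ring
      _ = _ := by rw [h2]; ring
  have hcover : Ka a ⊆ {x | x ∈ Ka a ∧ |v x| < 2 ^ k0} ∪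
      ⋃ n : ℕ, {x | x ∈ Ka a ∧ (2:ℝ) ^ (k0 + n) ≤ |v x| ∧ |v x| < 2 * 2 ^ (k0 + n)} := by
    intro x hx
    rcases lt_or_ge |v x| (2 ^ k0) with h | h
    · left; exact ⟨hx, h⟩
    · right
      obtain ⟨n, h1, h2⟩ := exists_nat_pow_near (x := |v x| / 2 ^ k0) (y := (2:ℝ))
        (by rw [le_div_iff₀ (by positivity)]; linarith) (by norm_num)
      rw [le_div_iff₀ (by positivity)] at h1
      rw [div_lt_iff₀ (by positivity)] at h2
      refine Set.mem_iUnion.2 ⟨n, hx, ?_, ?_⟩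
      · rw [pow_add]; linarith
      · calc _ < _ := h2
          _ = _ := by ring
  have hGeq : ∫⁻ z, Gden a ε P v z = ENNReal.ofReal
      (∫ x in Ka a, wden ε (P x) (v x) * ∑ j, Dop j v x ^ 2) := by
    unfold Gden
    rw [lintegral_indicator (Ka_open a).measurableSet,
      ofReal_integral_eq_lintegral_ofReal hint]
    apply Filter.Eventually.of_forall
    intro x
    have : 0 ≤ wden ε (P x) (v x) := by unfold wden; positivity
    exact mul_nonneg this (Finset.sum_nonneg fun j _ => sq_nonneg _)
  set Y := ∫ x in Ka a, wden ε (P x) (v x) * ∑ j, Dop j v x ^ 2 with hY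
  have hY0 : 0 ≤ Y := by
    apply integral_nonneg
    intro x
    have : 0 ≤ wden ε (P x) (v x) := by unfold wden; positivity
    exact mul_nonneg this (Finset.sum_nonneg fun j _ => sq_nonneg _)
  have hlow : ∫⁻ x in {x | x ∈ Ka a ∧ |v x| < 2 ^ k0}, ENNReal.ofReal (Fden r ε (P x) (v x))
      ≤ ENNReal.ofReal ((2 * 2 ^ k0) ^ (Pm + r) * V) := by
    have hpt : ∀ x ∈ {x | x ∈ Ka a ∧ |v x| < 2 ^ k0}, ENNReal.ofReal (Fden r ε (P x) (v x))
        ≤ ENNReal.ofReal ((2 * 2 ^ k0) ^ (Pm + r)) := by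
      rintro x ⟨hx, hx2⟩
      apply ENNReal.ofReal_le_ofReal
      refine (Fden_le hε hε1 (by linarith [hP1 x hx]) (by linarith) hx2).trans ?_
      apply Real.rpow_le_rpow_of_exponent_le (by linarith)
      linarith [hPm x hx]
    calc _ ≤ ∫⁻ x in {x | x ∈ Ka a ∧ |v x| < 2 ^ k0},
            ENNReal.ofReal ((2 * 2 ^ k0) ^ (Pm + r)) := setLIntegral_mono measurable_const hpt
      _ ≤ ∫⁻ x in Ka a, ENNReal.ofReal ((2 * 2 ^ k0) ^ (Pm + r)) :=
          lintegral_mono_set (fun x hx => hx.1)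
      _ = _ := by
          rw [setLIntegral_const, ← ofReal_measureReal hVtop.ne,
            ← ENNReal.ofReal_mul (by positivity)]
  have hsum : ∑' n : ℕ, ENNReal.ofReal (D * q ^ k0 * q ^ n) ≤ ENNReal.ofReal δ := by
    rw [← ENNReal.ofReal_tsum_of_nonneg (fun n => by positivity)
      ((summable_geometric_of_lt_one hq0.le hq1).mul_left _), tsum_mul_left,
      tsum_geometric_of_lt_one hq0.le hq1]
    exact ENNReal.ofReal_le_ofReal hkδ
  have htotal : ∫⁻ x in Ka a, ENNReal.ofReal (Fden r ε (P x) (v x))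
      ≤ ENNReal.ofReal (δ * Y + (2 * 2 ^ k0) ^ (Pm + r) * V) := by
    calc _ ≤ _ := lintegral_mono_set hcover
      _ ≤ _ := lintegral_union_le _ _ _
      _ ≤ ENNReal.ofReal ((2 * 2 ^ k0) ^ (Pm + r) * V) +
          ∑' n : ℕ, ENNReal.ofReal (D * q ^ k0 * q ^ n) * ENNReal.ofReal Y := by
          gcongr
          refine (lintegral_iUnion_le _ _).trans ?_
          refine ENNReal.tsum_le_tsum (fun n => ?_)
          rw [← hGeq]
          exact hlayer n
      _ ≤ ENNReal.ofReal ((2 * 2 ^ k0) ^ (Pm + r) * V) + ENNReal.ofReal δ * ENNReal.ofReal Y := by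
          rw [ENNReal.tsum_mul_right]
          gcongr
      _ = _ := by
          rw [← ENNReal.ofReal_mul hδ.le, ← ENNReal.ofReal_add (by positivity) (by positivity),
            add_comm]
  by_cases hFi : IntegrableOn (fun x => Fden r ε (P x) (v x)) (Ka a)
  · exact (ENNReal.ofReal_le_ofReal_iff (by positivity)).1 ((ofReal_integral_le' hFi).trans htotal)
  · rw [integral_undef hFi]; positivity

lemma box_uniqueDiff {N : ℕ} {a : Fin N → ℝ} (ha : ∀ i, 0 < a i) {T : ℝ} (hT : 0 < T) :
    UniqueDiffOn ℝ (closure (Ka a) ×ˢ Set.Icc 0 T) := by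
  apply UniqueDiffOn.prod
  · apply uniqueDiffOn_convex (Ka_convex a).closure
    exact ⟨0, interior_mono subset_closure ((Ka_open a).interior_eq.symm ▸ Ka_zero a ha)⟩
  · exact uniqueDiffOn_Icc hT

lemma ext_deriv {N : ℕ} {a : Fin N → ℝ} (ha : ∀ i, 0 < a i) {T : ℝ} (hT : 0 < T) (j : Fin N)
    {f : (Fin N → ℝ) × ℝ → ℝ}
    (hf : ContDiffOn ℝ (⊤ : ℕ∞) f (closure (Ka a) ×ˢ Set.Icc 0 T)) :
    ∃ g : (Fin N → ℝ) × ℝ → ℝ, ContDiffOn ℝ (⊤ : ℕ∞) g (closure (Ka a) ×ˢ Set.Icc 0 T) ∧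
      ∀ t ∈ Set.Ioo 0 T, ∀ x ∈ Ka a, Dop j (fun y => f (y, t)) x = g (x, t) := by
  set S := closure (Ka a) ×ˢ Set.Icc 0 T with hS
  refine ⟨fun z => fderivWithin ℝ f S z (Pi.single j 1, 0), ?_, ?_⟩
  · have h := hf.fderivWithin (m := (⊤ : ℕ∞)) (box_uniqueDiff ha hT) (by simp)
    exact h.clm_apply contDiffOn_const
  · intro t ht x hx
    have hnhds : S ∈ nhds (x, t) :=
      prod_mem_nhds (Filter.mem_of_superset ((Ka_open a).mem_nhds hx) subset_closure)
        (Icc_mem_nhds ht.1 ht.2)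
    have hd : DifferentiableAt ℝ f (x, t) :=
      ((hf.contDiffAt hnhds).differentiableAt (by simp))
    have h1 : HasFDerivAt (fun y : Fin N → ℝ => (y, t))
        (ContinuousLinearMap.inl ℝ (Fin N → ℝ) ℝ) x := hasFDerivAt_prodMk_left x t
    have h2 := (hd.hasFDerivAt.comp x h1).fderiv
    have h3 : fderiv ℝ (fun y => f (y, t)) x
      = (fderiv ℝ f (x, t)).comp (ContinuousLinearMap.inl ℝ (Fin N → ℝ) ℝ) := h2
    simp only [Dop, h3, fderivWithin_of_mem_nhds hnhds]
    simp

lemma Dop_congr {N : ℕ} {a : Fin N → ℝ} {f g : (Fin N → ℝ) → ℝ} (i : Fin N)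
    (h : ∀ x ∈ Ka a, f x = g x) {x : Fin N → ℝ} (hx : x ∈ Ka a) : Dop i f x = Dop i g x := by
  have : f =ᶠ[nhds x] g := Filter.mem_of_superset ((Ka_open a).mem_nhds hx) h
  simp only [Dop, this.fderiv_eq]

lemma Dop_comm {N : ℕ} {f : (Fin N → ℝ) → ℝ} (i j : Fin N) {x : Fin N → ℝ}
    (hf : ContDiffAt ℝ 2 f x) : Dop i (Dop j f) x = Dop j (Dop i f) x := by
  have hd : DifferentiableAt ℝ (fderiv ℝ f) x :=
    (hf.fderiv_right (m := 1) (by norm_num)).differentiableAt (by simp)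
  have key : ∀ k l : Fin N, Dop k (Dop l f) x
      = fderiv ℝ (fderiv ℝ f) x (Pi.single k 1) (Pi.single l 1) := by
    intro k l
    have : HasFDerivAt (Dop l f) ((ContinuousLinearMap.apply ℝ ℝ (Pi.single l 1)).comp
        (fderiv ℝ (fderiv ℝ f) x)) x :=
      (ContinuousLinearMap.apply ℝ ℝ (Pi.single l 1 : Fin N → ℝ)).hasFDerivAt.comp x
        hd.hasFDerivAt
    rw [Dop, this.fderiv]; rfl
  rw [key, key]
  exact (hf.isSymmSndFDerivAt (by simp)).eq _ _

lemma p_cont {N : ℕ} {S : Set ((Fin N → ℝ) × ℝ)} {q : (Fin N → ℝ) × ℝ → ℝ} {L : ℝ}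
    (h : ∀ z ∈ S, ∀ w ∈ S,
      |q z - q w| ≤ L * (Real.sqrt (∑ j, (z.1 j - w.1 j) ^ 2) + |z.2 - w.2|)) :
    ContinuousOn q S := by
  intro z hz
  rw [ContinuousWithinAt, tendsto_iff_dist_tendsto_zero]
  have hc : Continuous fun w : (Fin N → ℝ) × ℝ =>
      L * (Real.sqrt (∑ j, (w.1 j - z.1 j) ^ 2) + |w.2 - z.2|) := by fun_prop
  have ht : Filter.Tendsto (fun w : (Fin N → ℝ) × ℝ =>
      L * (Real.sqrt (∑ j, (w.1 j - z.1 j) ^ 2) + |w.2 - z.2|)) (nhdsWithin z S) (nhds 0) := by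
    have := hc.tendsto z
    simp at this
    exact this.mono_left nhdsWithin_le_nhds
  refine squeeze_zero' (Filter.Eventually.of_forall fun _ => dist_nonneg) ?_ ht
  filter_upwards [self_mem_nhdsWithin] with w hw
  rw [Real.dist_eq]; exact h w hw z hz

lemma mu_ge {N : ℕ} {α : Type*} (hne : (Finset.univ : Finset (Fin N)).Nonempty)
    (p : Fin N → α → ℝ) (U : Set α) (hU : U.Nonempty) (B : ℝ)
    (h1 : ∀ j, ∀ z ∈ U, 1 ≤ p j z) (hB : ∀ j, ∀ z ∈ U, p j z ≤ B) :
    1 ≤ sSup ((fun z =>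
      (Finset.univ.sup' hne fun j => p j z) / (Finset.univ.inf' hne fun j => p j z)) '' U) := by
  obtain ⟨z, hz⟩ := hU
  obtain ⟨k, hk⟩ := hne
  have hinf : ∀ z ∈ U, 1 ≤ Finset.univ.inf' ⟨k, hk⟩ fun j => p j z := fun z hz =>
    Finset.le_inf' _ _ fun j _ => h1 j z hz
  have hle : ∀ z, (Finset.univ.inf' ⟨k, hk⟩ fun j => p j z)
      ≤ Finset.univ.sup' ⟨k, hk⟩ fun j => p j z := fun z =>
    (Finset.inf'_le _ hk).trans (Finset.le_sup' (fun j => p j z) hk)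
  refine le_trans ?_ (le_csSup ?_ ⟨z, hz, rfl⟩)
  · have := hinf z hz
    rw [le_div_iff₀ (by linarith)]; linarith [hle z]
  · refine ⟨B, ?_⟩
    rintro _ ⟨w, hw, rfl⟩
    have h := hinf w hw
    have hs : (Finset.univ.sup' ⟨k, hk⟩ fun j => p j w) ≤ B :=
      Finset.sup'_le _ _ fun j _ => hB j w hw
    refine le_trans (div_le_self ?_ h) hs
    linarith [hle w]

theorem stmt16 (N : ℕ) (hN : 2 ≤ N) (hne : (Finset.univ : Finset (Fin N)).Nonempty)
    (a : Fin N → ℝ) (ha : ∀ i, 0 < a i) (T : ℝ) (hT : 0 < T) (L : ℝ) (hL : 0 ≤ L)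
    (p : Fin N → ((Fin N → ℝ) × ℝ) → ℝ)
    (hLip : ∀ i, ∀ z ∈ closure (Ka a) ×ˢ Set.Icc 0 T, ∀ w ∈ closure (Ka a) ×ˢ Set.Icc 0 T,
      |p i z - p i w| ≤ L * (Real.sqrt (∑ j, (z.1 j - w.1 j) ^ 2) + |z.2 - w.2|))
    (hp : ∀ i, ∀ z ∈ closure (Ka a) ×ˢ Set.Icc 0 T, 2 * N / (N + 2) < p i z)
    (μ : ℝ)
    (hμdef : μ = sSup ((fun z =>
      (Finset.univ.sup' hne fun j => p j z) / (Finset.univ.inf' hne fun j => p j z)) ''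
        (Ka a ×ˢ Set.Ioo 0 T)))
    (hμ : μ < 1 + 1 / N)
    (i : Fin N) (r : ℝ) (hr1 : 0 < r) (hr2 : r < (2 * N * (1 - μ) + 4) / (N + 2))
    (δ : ℝ) (hδ : δ ∈ Set.Ioo (0 : ℝ) 1) (M₀ : ℝ) (hM₀ : 0 < M₀) :
    ∃ C : ℝ, ∀ ε ∈ Set.Ioo (0 : ℝ) 1,
      ∀ u : (Fin N → ℝ) → ℝ → ℝ,
        ContDiffOn ℝ (⊤ : ℕ∞) (fun z : (Fin N → ℝ) × ℝ => u z.1 z.2)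
          (closure (Ka a) ×ˢ Set.Icc 0 T) →
        (∀ x ∈ frontier (Ka a), ∀ t ∈ Set.Icc 0 T, u x t = 0) →
        (∀ t ∈ Set.Ioo 0 T, Lnorm 2 (Ka a) (fun x => u x t) ≤ M₀) →
        (∫ t in Set.Ioo 0 T, ∫ x in Ka a,
            (ε ^ 2 + (Dop i (fun y => u y t) x) ^ 2) ^ ((p i (x, t) + r - 2) / 2) *
              (Dop i (fun y => u y t) x) ^ 2) ≤
          δ * (∑ j, ∫ t in Set.Ioo 0 T, ∫ x in Ka a,
              (ε ^ 2 + (Dop i (fun y => u y t) x) ^ 2) ^ ((p i (x, t) - 2) / 2) *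
                (Dop i (Dop j (fun y => u y t)) x) ^ 2) + C := by
  have hcl : Ka a ⊆ closure (Ka a) := subset_closure
  have hUS : Ka a ×ˢ Set.Ioo 0 T ⊆ closure (Ka a) ×ˢ Set.Icc 0 T :=
    Set.prod_mono hcl Set.Ioo_subset_Icc_self
  have hScomp : IsCompact (closure (Ka a) ×ˢ Set.Icc 0 T) :=
    (Ka_closure_compact a ha).prod isCompact_Icc
  have hNR : (2 : ℝ) ≤ N := by exact_mod_cast hN
  have hpc : ∀ j, ContinuousOn (p j) (closure (Ka a) ×ˢ Set.Icc 0 T) := fun j => p_cont (hLip j)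
  have hp1 : ∀ j, ∀ z ∈ closure (Ka a) ×ˢ Set.Icc 0 T, 1 ≤ p j z := by
    intro j z hz
    have h1 : (1 : ℝ) ≤ 2 * N / (N + 2) := by
      rw [le_div_iff₀ (by linarith)]; linarith
    linarith [hp j z hz]
  have hbd : ∀ j, ∃ B, ∀ z ∈ closure (Ka a) ×ˢ Set.Icc 0 T, p j z ≤ B := by
    intro j
    obtain ⟨B, hB⟩ := hScomp.exists_bound_of_continuousOn (hpc j)
    exact ⟨B, fun z hz => (le_abs_self _).trans (hB z hz)⟩
  choose B hB using hbd
  have hmu : 1 ≤ μ := by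
    rw [hμdef]
    refine mu_ge hne p _ ⟨(0, T / 2), Ka_zero a ha, by simp [hT], by linarith⟩ (∑ j, |B j|)
      (fun j z hz => hp1 j z (hUS hz)) (fun j z hz => ?_)
    refine (hB j z (hUS hz)).trans ((le_abs_self _).trans ?_)
    exact Finset.single_le_sum (f := fun j => |B j|) (fun k _ => abs_nonneg _) (Finset.mem_univ j)
  have hr : r < 4 / (N + 2) := by
    refine hr2.trans_le ?_
    gcongr
    nlinarith
  obtain ⟨C, hC0, hC⟩ := slice ha i (Pm := B i) hr1.le hr hδ.1 hM₀ hL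
  refine ⟨T * C, ?_⟩
  intro ε hε u hu _ hunorm
  have hKm : MeasurableSet (Ka a) := (Ka_open a).measurableSet
  obtain ⟨g, hg, hgE⟩ := ext_deriv ha hT i hu
  have hh : ∀ j, ∃ h : (Fin N → ℝ) × ℝ → ℝ,
      ContinuousOn h (closure (Ka a) ×ˢ Set.Icc 0 T) ∧
      ∀ t ∈ Set.Ioo 0 T, ∀ x ∈ Ka a, Dop i (Dop j (fun y => u y t)) x = h (x, t) := by
    intro j
    obtain ⟨g1, hg1, hg1E⟩ := ext_deriv ha hT j hu
    obtain ⟨g2, hg2, hg2E⟩ := ext_deriv ha hT i hg1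
    refine ⟨g2, hg2.continuousOn, fun t ht x hx => ?_⟩
    rw [← hg2E t ht x hx]
    exact Dop_congr i (fun y hy => hg1E t ht y hy) hx
  choose h hhc hhE using hh
  have hεp : ∀ v : ℝ, ε ^ 2 + v ^ 2 ≠ 0 := fun v => by
    have := hε.1; positivity
  -- continuous extension of the integrands
  have hPhi : ∀ j, ContinuousOn (fun z => (ε ^ 2 + g z ^ 2) ^ ((p i z - 2) / 2) * h j z ^ 2)
      (closure (Ka a) ×ˢ Set.Icc 0 T) := by
    intro j
    refine ContinuousOn.mul ?_ ((hhc j).pow 2)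
    refine ContinuousOn.rpow (continuousOn_const.add (hg.continuousOn.pow 2))
      (((hpc i).sub continuousOn_const).div_const 2) (fun z _ => Or.inl (hεp _))
  set Φ : Fin N → (Fin N → ℝ) × ℝ → ℝ :=
    fun j z => (ε ^ 2 + g z ^ 2) ^ ((p i z - 2) / 2) * h j z ^ 2 with hΦ
  have hEq : ∀ j, ∀ t ∈ Set.Ioo 0 T, ∀ x ∈ Ka a,
      (ε ^ 2 + (Dop i (fun y => u y t) x) ^ 2) ^ ((p i (x, t) - 2) / 2) *
        (Dop i (Dop j (fun y => u y t)) x) ^ 2 = Φ j (x, t) := by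
    intro j t ht x hx
    rw [hhE j t ht x hx, hgE t ht x hx]
  have hIntJ : ∀ j, Integrable (Φ j) ((volume.restrict (Ka a)).prod
      (volume.restrict (Set.Ioo 0 T))) := by
    intro j
    rw [Measure.prod_restrict]
    exact ((hPhi j).integrableOn_compact hScomp).mono_set hUS
  have hIntT : ∀ j, Integrable (fun t => ∫ x in Ka a, Φ j (x, t))
      (volume.restrict (Set.Ioo 0 T)) := fun j => (hIntJ j).integral_prod_right
  have hIntX : ∀ j, ∀ t ∈ Set.Ioo 0 T, IntegrableOn (fun x => Φ j (x, t)) (Ka a) := by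
    intro j t ht
    have : ContinuousOn (fun x => Φ j (x, t)) (closure (Ka a)) :=
      (hPhi j).comp (by fun_prop) (fun x hx => ⟨hx, Set.Ioo_subset_Icc_self ht⟩)
    exact (this.integrableOn_compact (Ka_closure_compact a ha)).mono_set hcl
  have hInner : ∀ j, ∀ t ∈ Set.Ioo 0 T, (∫ x in Ka a,
      (ε ^ 2 + (Dop i (fun y => u y t) x) ^ 2) ^ ((p i (x, t) - 2) / 2) *
        (Dop i (Dop j (fun y => u y t)) x) ^ 2) = ∫ x in Ka a, Φ j (x, t) := fun j t ht =>
    setIntegral_congr_fun hKm (fun x hx => hEq j t ht x hx)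
  have hR : (∑ j, ∫ t in Set.Ioo 0 T, ∫ x in Ka a,
      (ε ^ 2 + (Dop i (fun y => u y t) x) ^ 2) ^ ((p i (x, t) - 2) / 2) *
        (Dop i (Dop j (fun y => u y t)) x) ^ 2)
      = ∫ t in Set.Ioo 0 T, ∑ j, ∫ x in Ka a, Φ j (x, t) := by
    rw [integral_finsetSum _ (fun j _ => hIntT j)]
    refine Finset.sum_congr rfl fun j _ => ?_
    exact setIntegral_congr_fun measurableSet_Ioo (fun t ht => hInner j t ht)
  -- the slice estimate
  have hslice : ∀ t ∈ Set.Ioo 0 T, (∫ x in Ka a,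
      (ε ^ 2 + (Dop i (fun y => u y t) x) ^ 2) ^ ((p i (x, t) + r - 2) / 2) *
        (Dop i (fun y => u y t) x) ^ 2) ≤ δ * (∑ j, ∫ x in Ka a, Φ j (x, t)) + C := by
    intro t ht
    have htI := Set.Ioo_subset_Icc_self ht
    have hmaps : ∀ x ∈ closure (Ka a), ((x, t) : (Fin N → ℝ) × ℝ) ∈
        closure (Ka a) ×ˢ Set.Icc 0 T := fun x hx => ⟨hx, htI⟩
    have hut : ContDiffOn ℝ (⊤ : ℕ∞) (fun y => u y t) (closure (Ka a)) :=
      hu.comp (g := fun z : (Fin N → ℝ) × ℝ => u z.1 z.2) (f := fun y => (y, t))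
        (by fun_prop) hmaps
    have hut2 : ContDiffOn ℝ 2 (fun y => u y t) (Ka a) :=
      (hut.mono hcl).of_le (WithTop.coe_le_coe.2 (le_top : (2 : ℕ∞) ≤ ⊤))
    have hfun : ∀ x ∈ Ka a, wden ε (p i (x, t)) (Dop i (fun y => u y t) x) *
        ∑ j, Dop j (Dop i (fun y => u y t)) x ^ 2 = ∑ j, Φ j (x, t) := by
      intro x hx
      rw [Finset.mul_sum]
      refine Finset.sum_congr rfl fun j _ => ?_
      rw [← hEq j t ht x hx, Dop_comm j i (hut2.contDiffAt ((Ka_open a).mem_nhds hx))]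
      rfl
    have hint : IntegrableOn (fun x => wden ε (p i (x, t)) (Dop i (fun y => u y t) x) *
        ∑ j, Dop j (Dop i (fun y => u y t)) x ^ 2) (Ka a) := by
      refine IntegrableOn.congr_fun ?_ (fun x hx => (hfun x hx).symm) hKm
      exact integrable_finsetSum _ (fun j _ => hIntX j t ht)
    have hu2 : IntegrableOn (fun y => u y t ^ 2) (Ka a) :=
      ((hut.continuousOn.pow 2).integrableOn_compact (Ka_closure_compact a ha)).mono_set hcl
    have hnorm : ∫⁻ y in Ka a, ENNReal.ofReal (u y t ^ 2) ≤ ENNReal.ofReal (M₀ ^ 2) := by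
      rw [← ofReal_integral_eq_lintegral_ofReal hu2
        (Filter.Eventually.of_forall fun y => sq_nonneg _)]
      apply ENNReal.ofReal_le_ofReal
      have h1 := hunorm t ht
      have h2 : (∫ x in Ka a, |u x t| ^ (2 : ℝ)) = ∫ x in Ka a, u x t ^ 2 := by
        congr 1; ext x; rw [Real.rpow_two, sq_abs]
      rw [Lnorm, h2, ← Real.sqrt_eq_rpow] at h1
      exact (Real.sqrt_le_left hM₀.le).1 h1
    have hmain := hC ε hε (fun y => u y t) (fun y => p i (y, t)) hut2 hnorm
      (fun x hx => hp1 i _ (hmaps x (hcl hx))) (fun x hx => hB i _ (hmaps x (hcl hx)))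
      (fun x hx y hy => by
        simpa using hLip i _ (hmaps x (hcl hx)) _ (hmaps y (hcl hy)))
      ((hpc i).comp (by fun_prop) (fun x hx => hmaps x (hcl hx))) hint
    rw [setIntegral_congr_fun hKm hfun,
      integral_finsetSum _ (fun j _ => hIntX j t ht)] at hmain
    exact hmain
  rw [hR]
  have hsum : Integrable (fun t => ∑ j, ∫ x in Ka a, Φ j (x, t))
      (volume.restrict (Set.Ioo 0 T)) := integrable_finsetSum _ (fun j _ => hIntT j)
  calc _ ≤ ∫ t in Set.Ioo 0 T, (δ * (∑ j, ∫ x in Ka a, Φ j (x, t)) + C) := by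
        refine integral_mono_of_nonneg (Filter.Eventually.of_forall fun t => ?_)
          ((hsum.const_mul δ).add (integrable_const C)) ?_
        · refine integral_nonneg fun x => ?_
          have := hε.1
          positivity
        · exact (ae_restrict_iff' measurableSet_Ioo).2
            (Filter.Eventually.of_forall fun t ht => hslice t ht)
    _ = _ := by
        rw [integral_add (hsum.const_mul δ) (integrable_const C), integral_const_mul]
        simp [hT.le]
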